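/- Let (t_n)_{n≥2} be any sequence of positive inverse temperatures such that (t_n) is bounded and n·t_n → ∞ as n → ∞ (for example t_n = (log n)^{-1}, or t_n = t constant). If for each n the data X_1, …, X_n are i.i.d. N(θ_0, 1), then the expectation over the data of the estimated singular fluctuation of model M_N satisfies lim_{n→∞} E{ν̂(t_n)} = 1/2. -/

import Mathlib

open MeasureTheory ProbabilityTheory Real

/-- Normal likelihood density `p(x | θ) = (2π)^{-1/2} exp(−(x−θ)²/2)`. -/
noncomputable def normalLik (x θ : ℝ) : ℝ :=
  (Real.sqrt (2 * Real.pi))⁻¹ * Real.exp (-(x - θ)^2 / 2)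

/-- Estimated singular fluctuation `ν̂(t) = (t/2)∑ᵢ V^t[log p(Xᵢ|θ)]` of model
`M_N` at inverse temperature `t`, for data `X`, where `V^t` is the variance
under the tempered posterior `N(m_t, v_t)`,
`m_t = (nt·X̄ + m/v)/(nt + 1/v)` and `v_t = (nt + 1/v)⁻¹`. -/
noncomputable def nuHat (n : ℕ) (m v t : ℝ) (X : Fin n → ℝ) : ℝ :=
  let xbar := (∑ i, X i) / n
  let mt := (n * t * xbar + m / v) / (n * t + 1 / v)
  let vt := (n * t + 1 / v)⁻¹
  (t / 2) * ∑ i,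
    ((∫ θ, (Real.log (normalLik (X i) θ))^2 ∂(gaussianReal mt vt.toNNReal)) -
      (∫ θ, Real.log (normalLik (X i) θ) ∂(gaussianReal mt vt.toNNReal))^2)

open scoped NNReal

lemma log_normalLik (x θ : ℝ) :
    Real.log (normalLik x θ) = Real.log (√(2 * π))⁻¹ - (x - θ) ^ 2 / 2 := by
  rw [normalLik, Real.log_mul (by positivity) (by positivity), Real.log_exp]
  ring

lemma integrable_pow_gaussianReal (μ : ℝ) (s : ℝ≥0) (k : ℕ) :
    Integrable (fun z : ℝ => z ^ k) (gaussianReal μ s) :=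
  (memLp_id_gaussianReal (μ := μ) (v := s) k).integrable_norm_pow'.mono'
    (by fun_prop) (by simp)

lemma deriv_mul_exp_sq (s : ℝ) {p p' : ℝ → ℝ} (hp : ∀ t, HasDerivAt p (p' t) t) :
    deriv (fun t => p t * rexp (s * t ^ 2 / 2)) =
      fun t => (p' t + s * t * p t) * rexp (s * t ^ 2 / 2) := by
  funext t
  have hexp : HasDerivAt (fun t : ℝ => rexp (s * t ^ 2 / 2))
      (rexp (s * t ^ 2 / 2) * (s * t)) t := by
    convert! ((((hasDerivAt_id t).pow 2).const_mul s).div_const 2).exp using 1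
    simp; ring
  rw [((hp t).fun_mul hexp).deriv]
  ring

lemma integral_pow_gaussianReal_zero (s : ℝ≥0) (k : ℕ) :
    ∫ z, z ^ k ∂gaussianReal 0 s = iteratedDeriv k (fun t : ℝ => rexp (s * t ^ 2 / 2)) 0 := by
  have h := iteratedDeriv_mgf_zero (X := id) (μ := gaussianReal 0 s) (by simp) k
  rw [mgf_id_gaussianReal] at h
  simpa using h.symm

lemma iteratedDeriv_exp_sq (s : ℝ) :
    iteratedDeriv 1 (fun t : ℝ => rexp (s * t ^ 2 / 2)) =
      (fun t => (s * t) * rexp (s * t ^ 2 / 2)) ∧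
    iteratedDeriv 2 (fun t : ℝ => rexp (s * t ^ 2 / 2)) =
      (fun t => (s + s ^ 2 * t ^ 2) * rexp (s * t ^ 2 / 2)) ∧
    iteratedDeriv 3 (fun t : ℝ => rexp (s * t ^ 2 / 2)) =
      (fun t => (3 * s ^ 2 * t + s ^ 3 * t ^ 3) * rexp (s * t ^ 2 / 2)) ∧
    iteratedDeriv 4 (fun t : ℝ => rexp (s * t ^ 2 / 2)) =
      (fun t => (3 * s ^ 2 + 6 * s ^ 3 * t ^ 2 + s ^ 4 * t ^ 4) * rexp (s * t ^ 2 / 2)) := by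
  have hpow (c : ℝ) (k : ℕ) (t : ℝ) :
      HasDerivAt (fun t : ℝ => c * t ^ k) (c * (k * t ^ (k - 1))) t :=
    (hasDerivAt_pow k t).const_mul c
  have h1 : iteratedDeriv 1 (fun t : ℝ => rexp (s * t ^ 2 / 2)) =
      (fun t => (s * t) * rexp (s * t ^ 2 / 2)) := by
    have := deriv_mul_exp_sq s (p := fun _ => 1) (fun t => hasDerivAt_const t (1 : ℝ))
    simpa [iteratedDeriv_one] using this
  have h2 : iteratedDeriv 2 (fun t : ℝ => rexp (s * t ^ 2 / 2)) =
      (fun t => (s + s ^ 2 * t ^ 2) * rexp (s * t ^ 2 / 2)) := by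
    rw [iteratedDeriv_succ, h1]
    refine (deriv_mul_exp_sq s fun t => (hasDerivAt_id' t).const_mul s).trans ?_
    funext t; ring
  have h3 : iteratedDeriv 3 (fun t : ℝ => rexp (s * t ^ 2 / 2)) =
      (fun t => (3 * s ^ 2 * t + s ^ 3 * t ^ 3) * rexp (s * t ^ 2 / 2)) := by
    rw [iteratedDeriv_succ, h2]
    refine (deriv_mul_exp_sq s fun t => (hpow (s ^ 2) 2 t).const_add s).trans ?_
    funext t; push_cast; ring
  refine ⟨h1, h2, h3, ?_⟩
  rw [iteratedDeriv_succ, h3]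
  refine (deriv_mul_exp_sq s fun t =>
    ((hasDerivAt_id' t).const_mul (3 * s ^ 2)).fun_add (hpow (s ^ 3) 3 t)).trans ?_
  funext t; push_cast; ring

lemma integral_quartic_gaussianReal_zero (s : ℝ≥0) (a b c d e : ℝ) :
    ∫ z, (a + b * z + c * z ^ 2 + d * z ^ 3 + e * z ^ 4) ∂gaussianReal 0 s =
      a + c * s + e * (3 * s ^ 2) := by
  have hi (k : ℕ) (r : ℝ) : Integrable (fun z : ℝ => r * z ^ k) (gaussianReal 0 s) :=
    (integrable_pow_gaussianReal 0 s k).const_mul r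
  have hi1 : Integrable (fun z : ℝ => b * z) (gaussianReal 0 s) := by simpa using hi 1 b
  obtain ⟨-, h2, h3, h4⟩ := iteratedDeriv_exp_sq s
  have e2 := integral_pow_gaussianReal_zero s 2
  have e3 := integral_pow_gaussianReal_zero s 3
  have e4 := integral_pow_gaussianReal_zero s 4
  rw [h2] at e2
  rw [h3] at e3
  rw [h4] at e4
  simp only [ne_eq, OfNat.ofNat_ne_zero, not_false_eq_true, zero_pow, mul_zero, add_zero, zero_div,
    Real.exp_zero, mul_one] at e2 e3 e4
  rw [integral_add ((((integrable_const a).fun_add hi1).fun_add (hi 2 c)).fun_add (hi 3 d)) (hi 4 e),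
    integral_add (((integrable_const a).fun_add hi1).fun_add (hi 2 c)) (hi 3 d),
    integral_add ((integrable_const a).fun_add hi1) (hi 2 c),
    integral_add (integrable_const a) hi1]
  have e1 : ∫ z, b * z ∂gaussianReal 0 s = 0 := by
    rw [integral_const_mul b (fun z : ℝ => z), integral_id_gaussianReal, mul_zero]
  simp only [integral_const_mul, e1, e2, e3, e4, integral_const]
  simp

lemma integral_gaussianReal_eq_centered (μ : ℝ) (s : ℝ≥0) {f : ℝ → ℝ} (hf : Measurable f) :
    ∫ θ, f θ ∂gaussianReal μ s = ∫ z, f (μ + z) ∂gaussianReal 0 s := by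
  have h := gaussianReal_map_const_add (μ := 0) (v := s) μ
  rw [zero_add] at h
  rw [← h, integral_map (by fun_prop) hf.aestronglyMeasurable]

lemma posterior_variance_log_normalLik (μ x : ℝ) (s : ℝ≥0) :
    (∫ θ, (Real.log (normalLik x θ)) ^ 2 ∂gaussianReal μ s) -
      (∫ θ, Real.log (normalLik x θ) ∂gaussianReal μ s) ^ 2 =
      s ^ 2 / 2 + s * (x - μ) ^ 2 := by
  simp only [log_normalLik]
  rw [integral_gaussianReal_eq_centered μ s (by fun_prop),
    integral_gaussianReal_eq_centered μ s (by fun_prop)]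
  set A := Real.log (√(2 * π))⁻¹ - (x - μ) ^ 2 / 2 with hA
  have h1 := integral_quartic_gaussianReal_zero s A (x - μ) (-1 / 2) 0 0
  have h2 := integral_quartic_gaussianReal_zero s (A ^ 2) (2 * A * (x - μ))
    ((x - μ) ^ 2 - A) (-(x - μ)) (1 / 4)
  have e1 : (fun z : ℝ => Real.log (√(2 * π))⁻¹ - (x - (μ + z)) ^ 2 / 2) =
      fun z => A + (x - μ) * z + -1 / 2 * z ^ 2 + 0 * z ^ 3 + 0 * z ^ 4 := by
    funext z; rw [hA]; ring
  have e2 : (fun z : ℝ => (Real.log (√(2 * π))⁻¹ - (x - (μ + z)) ^ 2 / 2) ^ 2) =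
      fun z => A ^ 2 + 2 * A * (x - μ) * z + ((x - μ) ^ 2 - A) * z ^ 2 + -(x - μ) * z ^ 3
        + 1 / 4 * z ^ 4 := by
    funext z; rw [hA]; ring
  rw [e1, e2, h1, h2]
  ring

lemma integral_sq_gaussianReal_one (μ : ℝ) : ∫ x, x ^ 2 ∂gaussianReal μ 1 = 1 + μ ^ 2 := by
  have h := variance_eq_sub (memLp_id_gaussianReal (μ := μ) (v := 1) 2)
  simp only [variance_id_gaussianReal, Pi.pow_apply, id, integral_id_gaussianReal] at h
  simp at h
  linarith

section Data

variable (θ₀ : ℝ) (n : ℕ)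

lemma memLp_sum_pi_gaussianReal :
    MemLp (fun X : Fin n → ℝ => ∑ i, X i) 2 (Measure.pi fun _ : Fin n => gaussianReal θ₀ 1) :=
  memLp_finsetSum _ fun i _ =>
    (memLp_id_gaussianReal (μ := θ₀) (v := 1) 2).comp_measurePreserving
      (measurePreserving_eval (fun _ : Fin n => gaussianReal θ₀ 1) i)

lemma integral_sum_pi_gaussianReal :
    ∫ X, ∑ i, X i ∂(Measure.pi fun _ : Fin n => gaussianReal θ₀ 1) = n * θ₀ := by
  have h1 : Integrable (fun x : ℝ => x) (gaussianReal θ₀ 1) := by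
    simpa using integrable_pow_gaussianReal θ₀ 1 1
  rw [integral_finsetSum _ fun i _ =>
    integrable_comp_eval (μ := fun _ : Fin n => gaussianReal θ₀ 1) (i := i) h1]
  have (i : Fin n) : ∫ X, X i ∂(Measure.pi fun _ : Fin n => gaussianReal θ₀ 1) = θ₀ := by
    rw [integral_comp_eval (μ := fun _ : Fin n => gaussianReal θ₀ 1) (f := fun x => x)
      h1.aestronglyMeasurable, integral_id_gaussianReal]
  simp [this]

lemma integral_sum_sq_pi_gaussianReal :
    ∫ X, ∑ i, X i ^ 2 ∂(Measure.pi fun _ : Fin n => gaussianReal θ₀ 1) = n * (1 + θ₀ ^ 2) := by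
  have h1 := integrable_pow_gaussianReal θ₀ 1 2
  rw [integral_finsetSum _ fun i _ =>
    integrable_comp_eval (μ := fun _ : Fin n => gaussianReal θ₀ 1) (i := i) h1]
  have (i : Fin n) :
      ∫ X, X i ^ 2 ∂(Measure.pi fun _ : Fin n => gaussianReal θ₀ 1) = 1 + θ₀ ^ 2 := by
    rw [integral_comp_eval (μ := fun _ : Fin n => gaussianReal θ₀ 1) (f := fun x => x ^ 2)
      h1.aestronglyMeasurable, integral_sq_gaussianReal_one]
  simp only [this, Finset.sum_const, Finset.card_univ, Fintype.card_fin, nsmul_eq_mul]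

lemma integral_sq_sum_pi_gaussianReal :
    ∫ X, (∑ i, X i) ^ 2 ∂(Measure.pi fun _ : Fin n => gaussianReal θ₀ 1) =
      n + (n * θ₀) ^ 2 := by
  have hvar := variance_sum_pi (μ := fun _ : Fin n => gaussianReal θ₀ 1)
    (X := fun _ => id) fun _ => memLp_id_gaussianReal 2
  have e : (∑ i, fun ω : Fin n → ℝ => id (ω i)) = fun X : Fin n → ℝ => ∑ i, X i := by
    ext; simp
  rw [e, variance_eq_sub (memLp_sum_pi_gaussianReal θ₀ n)] at hvar
  simp only [variance_id_gaussianReal, Pi.pow_apply, integral_sum_pi_gaussianReal] at hvar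
  simp at hvar
  linarith

lemma integrable_sum_sub_sq_pi_gaussianReal (a b : ℝ) :
    Integrable (fun X : Fin n → ℝ => ∑ i, (X i - (a * ((∑ j, X j) / n) + b)) ^ 2)
      (Measure.pi fun _ : Fin n => gaussianReal θ₀ 1) := by
  have hmean : MemLp (fun X : Fin n → ℝ => a * ((∑ j, X j) / n) + b) 2
      (Measure.pi fun _ : Fin n => gaussianReal θ₀ 1) := by
    simp only [div_eq_mul_inv]
    exact (((memLp_sum_pi_gaussianReal θ₀ n).mul_const _).const_mul a).add (memLp_const b)
  exact integrable_finsetSum _ fun i _ =>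
    (((memLp_id_gaussianReal (μ := θ₀) (v := 1) 2).comp_measurePreserving
      (measurePreserving_eval (fun _ : Fin n => gaussianReal θ₀ 1) i)).sub hmean).integrable_sq

lemma integral_sum_sub_sq_pi_gaussianReal (hn : n ≠ 0) (a b : ℝ) :
    ∫ X, ∑ i, (X i - (a * ((∑ j, X j) / n) + b)) ^ 2
        ∂(Measure.pi fun _ : Fin n => gaussianReal θ₀ 1) =
      n - 2 * a + a ^ 2 + n * ((1 - a) * θ₀ - b) ^ 2 := by
  have hn' : (n : ℝ) ≠ 0 := by exact_mod_cast hn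
  have hS := memLp_sum_pi_gaussianReal θ₀ n
  have hiS := hS.integrable one_le_two
  have hiS2 := hS.integrable_sq
  have hi2 : Integrable (fun X : Fin n → ℝ => ∑ i, X i ^ 2)
      (Measure.pi fun _ : Fin n => gaussianReal θ₀ 1) :=
    integrable_finsetSum _ fun i _ => integrable_comp_eval
      (μ := fun _ : Fin n => gaussianReal θ₀ 1) (i := i) (integrable_pow_gaussianReal θ₀ 1 2)
  have hexpand (X : Fin n → ℝ) : ∑ i, (X i - (a * ((∑ j, X j) / n) + b)) ^ 2 =
      (∑ i, X i ^ 2) + ((a ^ 2 - 2 * a) / n) * (∑ i, X i) ^ 2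
        + (2 * a * b - 2 * b) * (∑ i, X i) + n * b ^ 2 := by
    simp only [sub_sq, Finset.sum_add_distrib, Finset.sum_sub_distrib, ← Finset.sum_mul,
      ← Finset.mul_sum, Finset.sum_const, Finset.card_univ, Fintype.card_fin, nsmul_eq_mul]
    field_simp
    ring
  simp only [hexpand]
  rw [integral_add ((hi2.fun_add (hiS2.const_mul _)).fun_add (hiS.const_mul _)) (integrable_const _),
    integral_add (hi2.fun_add (hiS2.const_mul _)) (hiS.const_mul _),
    integral_add hi2 (hiS2.const_mul _), integral_const_mul, integral_const_mul,
    integral_sum_sq_pi_gaussianReal, integral_sq_sum_pi_gaussianReal,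
    integral_sum_pi_gaussianReal]
  simp
  field_simp
  ring

/-- The factor `n t s`, where `s = (n t + 1/v)⁻¹` is the posterior variance, is the weight of the
sample mean in the posterior mean. -/
lemma integral_nuHat (hn : n ≠ 0) {m v t s a : ℝ} (hv : 0 < v) (ht : 0 < t)
    (hs : s = (n * t + 1 / v)⁻¹) (ha : a = n * t * s) :
    ∫ X, nuHat n m v t X ∂(Measure.pi fun _ : Fin n => gaussianReal θ₀ 1) =
      a * s / 4 + a / 2 + t * s / 2 * (a ^ 2 - 2 * a) + a / 2 * (s / v * (θ₀ - m)) ^ 2 := by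
  have hpos : (0 : ℝ) < n * t + 1 / v := by positivity
  have hs0 : 0 < s := hs ▸ inv_pos.mpr hpos
  have h1a : 1 - a = s / v := by
    rw [ha, hs]; field_simp [hpos.ne']; ring
  have hnu (X : Fin n → ℝ) : nuHat n m v t X =
      a * s / 4 + t * s / 2 * ∑ i, (X i - (a * ((∑ j, X j) / n) + s * m / v)) ^ 2 := by
    have hm : (n * t * ((∑ j, X j) / n) + m / v) / (n * t + 1 / v) =
        a * ((∑ j, X j) / n) + s * m / v := by
      rw [div_eq_mul_inv _ ((n : ℝ) * t + 1 / v), ← hs, ha]; ring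
    simp only [nuHat, posterior_variance_log_normalLik, hm, ← hs, Real.coe_toNNReal s hs0.le,
      Finset.sum_add_distrib, ← Finset.mul_sum, Finset.sum_const, Finset.card_univ,
      Fintype.card_fin, nsmul_eq_mul]
    rw [ha]; ring
  have hint := integrable_sum_sub_sq_pi_gaussianReal θ₀ n a (s * m / v)
  simp only [hnu]
  rw [integral_add (integrable_const _) (hint.const_mul _), integral_const_mul,
    integral_sum_sub_sq_pi_gaussianReal θ₀ n hn, h1a]
  simp
  rw [ha]; ring

end Data

/-- for any bounded sequence `tₙ > 0` of inverse temperatures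
with `n·tₙ → ∞` (e.g. `tₙ = (log n)⁻¹`), if for each `n` the data are i.i.d.
`N(θ₀, 1)`, then `E{ν̂(tₙ)} → 1/2` as `n → ∞`. -/
theorem normal_expected_nuhat_tendsto_half
    (θ₀ m v : ℝ) (hv : 0 < v)
    (t : ℕ → ℝ) (htpos : ∀ n, 0 < t n)
    (htbdd : ∃ C : ℝ, ∀ n, t n ≤ C)
    (hnt : Filter.Tendsto (fun n : ℕ => (n : ℝ) * t n) Filter.atTop Filter.atTop) :
    Filter.Tendsto
      (fun n : ℕ =>
        ∫ X, nuHat n m v (t n) X ∂(Measure.pi fun _ : Fin n => gaussianReal θ₀ 1))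
      Filter.atTop (nhds (1 / 2)) := by
  obtain ⟨C, hC⟩ := htbdd
  set s : ℕ → ℝ := fun n => (n * t n + 1 / v)⁻¹ with hs
  have hpos (n : ℕ) : 0 < (n : ℝ) * t n + 1 / v := by have := htpos n; positivity
  have hs0 : Filter.Tendsto s Filter.atTop (nhds 0) :=
    (Filter.tendsto_atTop_add_const_right _ _ hnt).inv_tendsto_atTop
  have ha : Filter.Tendsto (fun n => n * t n * s n) Filter.atTop (nhds 1) := by
    have h := (hs0.div_const v).const_sub 1
    rw [zero_div, sub_zero] at h
    refine h.congr fun n => ?_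
    have h1 : ((n : ℝ) * t n + 1 / v) * s n = 1 := mul_inv_cancel₀ (hpos n).ne'
    linear_combination -h1
  have hts : Filter.Tendsto (fun n => t n * s n) Filter.atTop (nhds 0) := by
    have h := hs0.const_mul C
    rw [mul_zero] at h
    have hsn (n : ℕ) : 0 ≤ s n := (inv_pos.mpr (hpos n)).le
    exact squeeze_zero (fun n => mul_nonneg (htpos n).le (hsn n))
      (fun n => mul_le_mul_of_nonneg_right (hC n) (hsn n)) h
  have hlim := ((((ha.mul hs0).div_const 4).add (ha.div_const 2)).add
    ((hts.div_const 2).mul ((ha.pow 2).sub (ha.const_mul 2)))).add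
    ((ha.div_const 2).mul (((hs0.div_const v).mul_const (θ₀ - m)).pow 2))
  have hval : (1 : ℝ) * 0 / 4 + 1 / 2 + 0 / 2 * (1 ^ 2 - 2 * 1) + 1 / 2 * (0 / v * (θ₀ - m)) ^ 2
      = 1 / 2 := by simp
  rw [hval] at hlim
  refine hlim.congr' ?_
  filter_upwards [Filter.eventually_ne_atTop 0] with n hn
  exact (integral_nuHat θ₀ n hn hv (htpos n) rfl rfl).symm
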